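/- Let f ∈ ℂ[X] with deg f > 1, and let (u_1,…,u_r) and (v_1,…,v_s) be two complete decompositions of f. Then r = s, and there is a permutation χ of {1,2,…,r} such that deg u_i = deg v_{χ(i)} for all 1 ≤ i ≤ r; equivalently, the multiset {deg u_1,…,deg u_r} equals the multiset {deg v_1,…,deg v_s}. -/

import Mathlib

open Polynomial

/-- A polynomial `u ∈ ℂ[X]` is indecomposable if `deg u > 1` and `u` is not the
composition of two polynomials each of degree strictly less than `deg u`. -/
def Indecomposable (u : ℂ[X]) : Prop :=
  1 < u.natDegree ∧
    ¬ ∃ g h : ℂ[X], g.natDegree < u.natDegree ∧ h.natDegree < u.natDegree ∧ u = g.comp h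

/-- The composition `u_1 ∘ u_2 ∘ ⋯ ∘ u_r` of a list of polynomials. -/
noncomputable def compList (L : List ℂ[X]) : ℂ[X] :=
  L.foldr Polynomial.comp Polynomial.X

/-- A complete decomposition of `f` is a finite sequence of indecomposable
polynomials whose composition is `f`. -/
def CompleteDecomp (f : ℂ[X]) (L : List ℂ[X]) : Prop :=
  (∀ u ∈ L, Indecomposable u) ∧ f = compList L

open LaurentSeries

/-- The automorphism `t ↦ ζ t` of the field of Laurent series in `t` over `ℂ`. -/
noncomputable def rotate (ζ : ℂˣ) : ℂ⸨X⸩ →ₐ[ℂ] ℂ⸨X⸩ where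
  toFun z :=
    { coeff := fun i => ((ζ ^ i : ℂˣ) : ℂ) * z.coeff i
      isPWO_support' := z.isPWO_support.mono fun _ hi => right_ne_zero_of_mul hi }
  map_zero' := by ext; simp
  map_one' := by
    ext i
    by_cases hi : i = 0 <;> simp [HahnSeries.coeff_one, hi]
  map_add' x y := by ext; simp [mul_add]
  map_mul' x y := by
    ext i
    rw [HahnSeries.coeff_mul]
    have hs (z : ℂ⸨X⸩) : HahnSeries.support (⟨fun i => ((ζ ^ i : ℂˣ) : ℂ) * z.coeff i,
        z.isPWO_support.mono fun i hi => right_ne_zero_of_mul hi⟩ : ℂ⸨X⸩) = z.support := by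
      ext i
      exact mul_ne_zero_iff_left (Units.ne_zero _)
    simp only [HahnSeries.coeff_mul, hs, Finset.mul_sum]
    refine Finset.sum_congr rfl fun p hp => ?_
    rw [← (Finset.mem_antidiagonal.mp hp).2.2, zpow_add]
    push_cast
    ring
  commutes' c := by
    ext i
    rw [LaurentSeries.algebraMap_apply]
    by_cases hi : i = 0 <;> simp [hi]

@[simp]
theorem coeff_rotate (ζ : ℂˣ) (z : ℂ⸨X⸩) (i : ℤ) :
    (rotate ζ z).coeff i = ((ζ ^ i : ℂˣ) : ℂ) * z.coeff i := rfl

theorem rotate_mul (ζ ξ : ℂˣ) (z : ℂ⸨X⸩) : rotate (ζ * ξ) z = rotate ζ (rotate ξ z) := by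
  ext i
  simp [mul_zpow, mul_assoc]

/-- All exponents of the Laurent series `z` are divisible by `m`. -/
def SupportedOn (m : ℕ) (z : ℂ⸨X⸩) : Prop := ∀ i, z.coeff i ≠ 0 → (m : ℤ) ∣ i

theorem supportedOn_iff_rotate {m : ℕ} (hm : m ≠ 0) (z : ℂ⸨X⸩) :
    SupportedOn m z ↔ ∀ ζ : rootsOfUnity m ℂ, rotate ζ z = z := by
  constructor
  · intro h ζ
    ext i
    by_cases hi : z.coeff i = 0
    · simp [hi]
    obtain ⟨k, rfl⟩ := h i hi
    have : (ζ : ℂˣ) ^ m = 1 := ζ.2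
    simp [zpow_mul, this]
  · intro h i hi
    have hp := Complex.isPrimitiveRoot_exp m hm
    have hu : IsPrimitiveRoot (hp.isUnit hm).unit m :=
      IsPrimitiveRoot.coe_units_iff.mp (by simpa using hp)
    have := congrArg (fun w => HahnSeries.coeff w i)
      (h ⟨(hp.isUnit hm).unit, hu.pow_eq_one⟩)
    rw [coeff_rotate, mul_eq_right₀ hi, Units.val_eq_one] at this
    exact (hu.zpow_eq_one_iff_dvd i).mp this

theorem SupportedOn.mono {m k : ℕ} (h : k ∣ m) {z : ℂ⸨X⸩} (hz : SupportedOn m z) :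
    SupportedOn k z :=
  fun i hi => (Int.natCast_dvd_natCast.mpr h).trans (hz i hi)

theorem SupportedOn.lcm {m k : ℕ} {z : ℂ⸨X⸩} (hm : SupportedOn m z) (hk : SupportedOn k z) :
    SupportedOn (m.lcm k) z := by
  intro i hi
  exact Int.natCast_dvd.mpr
    (Nat.lcm_dvd (Int.natCast_dvd.mp (hm i hi)) (Int.natCast_dvd.mp (hk i hi)))

noncomputable instance (m : ℕ) [NeZero m] : Fintype (rootsOfUnity m ℂ) := Fintype.ofFinite _

theorem fintype_card_rootsOfUnity (m : ℕ) [NeZero m] : Fintype.card (rootsOfUnity m ℂ) = m := by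
  rw [← Nat.card_eq_fintype_card, Complex.card_rootsOfUnity]

/-- The sum of the conjugates of `z` under the rotations by `m`-th roots of unity. -/
noncomputable def rotateSum (m : ℕ) [NeZero m] (z : ℂ⸨X⸩) : ℂ⸨X⸩ :=
  ∑ ζ : rootsOfUnity m ℂ, rotate ζ z

theorem supportedOn_rotateSum (m : ℕ) [NeZero m] (z : ℂ⸨X⸩) :
    SupportedOn m (rotateSum m z) := by
  rw [supportedOn_iff_rotate (NeZero.ne m)]
  intro ξ
  simp only [rotateSum, map_sum, ← rotate_mul]
  exact Fintype.sum_equiv (Equiv.mulLeft ξ) _ _ fun ζ => rfl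

theorem rotate_rotateSum (ξ : ℂˣ) (m : ℕ) [NeZero m] (z : ℂ⸨X⸩) :
    rotate ξ (rotateSum m z) = rotateSum m (rotate ξ z) := by
  simp only [rotateSum, map_sum, ← rotate_mul, mul_comm]

theorem rotateSum_comm (m k : ℕ) [NeZero m] [NeZero k] (z : ℂ⸨X⸩) :
    rotateSum m (rotateSum k z) = rotateSum k (rotateSum m z) := by
  rw [rotateSum, rotateSum.eq_1 m z]
  simp only [rotate_rotateSum]
  simp only [rotateSum, map_sum]
  exact Finset.sum_comm

theorem coeff_rotateSum_eq_zero (m : ℕ) [NeZero m] {z : ℂ⸨X⸩} {i : ℤ} (h : z.coeff i = 0) :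
    (rotateSum m z).coeff i = 0 := by
  simp [rotateSum, HahnSeries.coeff_sum, h]

theorem coeff_rotateSum_of_dvd {m : ℕ} [NeZero m] (z : ℂ⸨X⸩) {i : ℤ} (h : (m : ℤ) ∣ i) :
    (rotateSum m z).coeff i = m * z.coeff i := by
  have hc (ζ : rootsOfUnity m ℂ) : (rotate ζ z).coeff i = z.coeff i := by
    obtain ⟨k, rfl⟩ := h
    have : (ζ : ℂˣ) ^ m = 1 := ζ.2
    simp [zpow_mul, this]
  simp [rotateSum, HahnSeries.coeff_sum, hc, fintype_card_rootsOfUnity]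

/-- The Laurent series `z` in `1/t` has a pole of order at most `d`, and `c` is its coefficient
of exponent `-d`. -/
def HasLeadingTerm (z : ℂ⸨X⸩) (d : ℕ) (c : ℂ) : Prop :=
  (∀ i < -(d : ℤ), z.coeff i = 0) ∧ z.coeff (-d) = c

/-- Substituting `x` into polynomials behaves like expansion at infinity. -/
def IsExpansionAtInfinity (x : ℂ⸨X⸩) : Prop :=
  ∀ P : ℂ[X], HasLeadingTerm (aeval x P) P.natDegree P.leadingCoeff

theorem IsExpansionAtInfinity.natDegree_eq {x : ℂ⸨X⸩} (hx : IsExpansionAtInfinity x) {P : ℂ[X]}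
    {d : ℕ} {c : ℂ} (h : HasLeadingTerm (aeval x P) d c) (hc : c ≠ 0) : P.natDegree = d := by
  have hP := hx P
  have hP0 : P.leadingCoeff ≠ 0 := by
    rw [leadingCoeff_ne_zero]
    rintro rfl
    exact hc (by simpa using h.2.symm)
  apply le_antisymm
  · by_contra! hlt
    exact hP0 (hP.2 ▸ h.1 _ (by simpa using hlt))
  · by_contra! hlt
    exact hc (h.2 ▸ hP.1 _ (by simpa using hlt))

theorem IsExpansionAtInfinity.aeval_injective {x : ℂ⸨X⸩} (hx : IsExpansionAtInfinity x) :
    Function.Injective (aeval x : ℂ[X] →ₐ[ℂ] ℂ⸨X⸩) := by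
  rw [injective_iff_map_eq_zero]
  intro P hP
  have := (hx P).2
  rw [hP] at this
  simpa using this.symm

theorem IsExpansionAtInfinity.rotate_injective {x : ℂ⸨X⸩} (hx : IsExpansionAtInfinity x) :
    Function.Injective fun ζ : ℂˣ => rotate ζ x := by
  intro ζ ξ h
  have h1 := (hx X).2
  simp only [aeval_X, natDegree_X, leadingCoeff_X] at h1
  have := congrArg (fun w => HahnSeries.coeff w (-((1 : ℕ) : ℤ))) h
  exact Units.ext (by simpa [show x.coeff (-1) = 1 from h1] using this)

/-- The polynomial `X ^ deg P * P (Y / X)` in `Y` over the power series in `X`. -/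
noncomputable def homogenization (P : ℂ[X]) : (PowerSeries ℂ)[X] :=
  (P.map PowerSeries.C).scaleRoots PowerSeries.X

theorem map_constantCoeff_homogenization (P : ℂ[X]) :
    (homogenization P).map PowerSeries.constantCoeff = C P.leadingCoeff * X ^ P.natDegree := by
  by_cases hP : P = 0
  · simp [homogenization, hP]
  have hl : (P.map (PowerSeries.C (R := ℂ))).leadingCoeff = PowerSeries.C P.leadingCoeff :=
    leadingCoeff_map_of_injective PowerSeries.C_injective P
  rw [homogenization, map_scaleRoots _ _ _ (by simpa [hl] using hP), Polynomial.map_map]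
  have : (PowerSeries.constantCoeff (R := ℂ)).comp PowerSeries.C = RingHom.id ℂ := by
    ext; simp
  simp [this, smul_eq_C_mul]

theorem monic_homogenization {P : ℂ[X]} (hP : P.Monic) : (homogenization P).Monic :=
  (monic_scaleRoots_iff _).mpr (hP.map _)

theorem natDegree_homogenization (P : ℂ[X]) : (homogenization P).natDegree = P.natDegree := by
  rw [homogenization, natDegree_scaleRoots, natDegree_map_eq_of_injective PowerSeries.C_injective]

theorem coeff_aeval_single_mul (y : PowerSeries ℂ) (P : ℂ[X]) (i : ℤ) :
    (aeval (HahnSeries.single (-1) 1 * HahnSeries.ofPowerSeries ℤ ℂ y) P).coeff i =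
      (HahnSeries.ofPowerSeries ℤ ℂ ((homogenization P).eval y)).coeff (i + P.natDegree) := by
  set x : ℂ⸨X⸩ := HahnSeries.single (-1) 1 * HahnSeries.ofPowerSeries ℤ ℂ y with hx
  set ι := HahnSeries.ofPowerSeries ℤ ℂ
  have hXx : ι PowerSeries.X * x = ι y := by
    rw [hx, HahnSeries.ofPowerSeries_X, ← mul_assoc, HahnSeries.single_mul_single]
    simp
  have h := scaleRoots_eval₂_mul (p := P.map PowerSeries.C) ι x PowerSeries.X
  rw [hXx, eval₂_map, natDegree_map_eq_of_injective PowerSeries.C_injective,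
    ← map_pow, HahnSeries.ofPowerSeries_X_pow] at h
  have hC : ι.comp PowerSeries.C = algebraMap ℂ ℂ⸨X⸩ := by
    ext c : 1
    rw [LaurentSeries.algebraMap_apply, RingHom.comp_apply, HahnSeries.ofPowerSeries_C]
  rw [hC, ← aeval_def, ← homogenization, eval₂_at_apply] at h
  rw [h, HahnSeries.coeff_single_mul]
  simp

theorem isExpansionAtInfinity_single_mul {y : PowerSeries ℂ}
    (hy : PowerSeries.constantCoeff y = 1) :
    IsExpansionAtInfinity (HahnSeries.single (-1) 1 * HahnSeries.ofPowerSeries ℤ ℂ y) := by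
  intro P
  constructor
  · intro i hi
    rw [coeff_aeval_single_mul, PowerSeries.coeff_coe, if_pos (by omega)]
  · have : PowerSeries.constantCoeff ((homogenization P).eval y) = P.leadingCoeff := by
      rw [← eval_map_apply, map_constantCoeff_homogenization]
      simp [hy]
    rw [coeff_aeval_single_mul, PowerSeries.coeff_coe]
    simp [this]

theorem exists_homogenization_eval_eq_one {f : ℂ[X]} (hm : f.Monic) (hf : 0 < f.natDegree) :
    ∃ y : PowerSeries ℂ, PowerSeries.constantCoeff y = 1 ∧ (homogenization f).eval y = 1 := by
  have hH : (homogenization f - 1).Monic := by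
    refine (monic_homogenization hm).sub_of_left ?_
    rw [degree_one, ← natDegree_pos_iff_degree_pos, natDegree_homogenization]
    exact hf
  have hmap : (homogenization f - 1).map PowerSeries.constantCoeff = X ^ f.natDegree - 1 := by
    simp [map_constantCoeff_homogenization, hm.leadingCoeff]
  have hmem (z : PowerSeries ℂ) :
      z ∈ Ideal.span {PowerSeries.X} ↔ PowerSeries.constantCoeff z = 0 := by
    rw [Ideal.mem_span_singleton, PowerSeries.X_dvd_iff]
  obtain ⟨y, hy, hy1⟩ := HenselianRing.is_henselian (I := Ideal.span {PowerSeries.X}) _ hH 1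
    (by
      have := eval_map_apply (p := homogenization f - 1) (PowerSeries.constantCoeff (R := ℂ)) 1
      rw [hmem, ← this, hmap]
      simp)
    (by
      have := eval_map_apply (p := (homogenization f - 1).derivative)
        (PowerSeries.constantCoeff (R := ℂ)) 1
      rw [← derivative_map, hmap] at this
      refine IsUnit.map _ (PowerSeries.isUnit_iff_constantCoeff.mpr ?_)
      rw [← this]
      simpa [derivative_X_pow] using hf.ne')
  refine ⟨y, ?_, ?_⟩
  · rw [hmem, map_sub, map_one, sub_eq_zero] at hy1
    exact hy1
  · simpa [sub_eq_zero] using hy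

theorem exists_isExpansionAtInfinity {f : ℂ[X]} (hf : 0 < f.natDegree) :
    ∃ x : ℂ⸨X⸩, IsExpansionAtInfinity x ∧ SupportedOn f.natDegree (aeval x f) := by
  have hf0 : f ≠ 0 := by rintro rfl; simp at hf
  have hm : (f * C f.leadingCoeff⁻¹).Monic := monic_mul_leadingCoeff_inv hf0
  have hd : (f * C f.leadingCoeff⁻¹).natDegree = f.natDegree :=
    natDegree_mul_leadingCoeff_inv f hf0
  obtain ⟨y, hy, hy1⟩ := exists_homogenization_eval_eq_one hm (hd ▸ hf)
  refine ⟨_, isExpansionAtInfinity_single_mul hy, fun i hi => ?_⟩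
  have h := coeff_aeval_single_mul y (f * C f.leadingCoeff⁻¹) i
  rw [hy1, hd, map_one (HahnSeries.ofPowerSeries ℤ ℂ), HahnSeries.coeff_one, map_mul, aeval_C,
    LaurentSeries.algebraMap_apply,
    mul_comm, HahnSeries.C_mul_eq_smul, HahnSeries.coeff_smul] at h
  by_cases hin : i + f.natDegree = 0
  · exact ⟨-1, by omega⟩
  · simp [hin, hf0] at h
    exact absurd h hi

theorem IsExpansionAtInfinity.pow_eq_of_rotate_eq {x : ℂ⸨X⸩} (hx : IsExpansionAtInfinity x)
    {b : ℂ[X]} (hb : b ≠ 0) {α β : ℂˣ} (h : rotate α (aeval x b) = rotate β (aeval x b)) :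
    α ^ b.natDegree = β ^ b.natDegree := by
  have h1 := congrArg (fun w => HahnSeries.coeff w (-(b.natDegree : ℤ))) h
  simp only [coeff_rotate, (hx b).2, mul_left_inj' (leadingCoeff_ne_zero.mpr hb), Units.val_inj,
    zpow_neg, zpow_natCast, inv_inj] at h1
  exact h1

theorem IsExpansionAtInfinity.supportedOn_of_comp {x : ℂ⸨X⸩} (hx : IsExpansionAtInfinity x)
    {A b : ℂ[X]} (hpos : 0 < (A.comp b).natDegree)
    (hf : SupportedOn (A.comp b).natDegree (aeval x (A.comp b))) :
    SupportedOn b.natDegree (aeval x b) := by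
  rw [natDegree_comp] at hpos
  have hr : 0 < A.natDegree := Nat.pos_of_mul_pos_right hpos
  have hm : 0 < b.natDegree := Nat.pos_of_mul_pos_left hpos
  have hb : b ≠ 0 := by rintro rfl; simp at hm
  rw [supportedOn_iff_rotate hm.ne']
  rw [natDegree_comp, supportedOn_iff_rotate hpos.ne', aeval_comp] at hf
  rintro ⟨ζ, hζ⟩
  rw [mem_rootsOfUnity] at hζ
  change rotate ζ _ = _
  set n := A.natDegree * b.natDegree with hn
  have hp := Complex.isPrimitiveRoot_exp n hpos.ne'
  set ω := (hp.isUnit hpos.ne').unit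
  have hω : IsPrimitiveRoot ω n := IsPrimitiveRoot.coe_units_iff.mp (by simpa [ω] using hp)
  set p : (ℂ⸨X⸩)[X] := A.map (algebraMap ℂ ℂ⸨X⸩) - C (aeval (aeval x b) A) with hpdef
  have hdeg : p.natDegree = A.natDegree := by
    rw [hpdef, natDegree_sub_C, natDegree_map]
  have hp0 : p ≠ 0 := by
    intro h
    rw [h, natDegree_zero] at hdeg
    omega
  have hroot (ξ : ℂˣ) (hξ : ξ ^ n = 1) : rotate ξ (aeval x b) ∈ p.roots := by
    rw [mem_roots hp0, IsRoot, hpdef, eval_sub, eval_C, eval_map_algebraMap, aeval_algHom_apply,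
      hf ⟨ξ, hξ⟩, sub_self]
  classical
  have hωpow (j : ℕ) : (ω ^ j) ^ n = 1 := by
    rw [← pow_mul, mul_comm, pow_mul, hω.pow_eq_one, one_pow]
  have hinj : Set.InjOn (fun j : ℕ => rotate (ω ^ j) (aeval x b)) (Finset.range A.natDegree) := by
    intro i hi j hj hij
    have h := hx.pow_eq_of_rotate_eq hb hij
    rw [← pow_mul, ← pow_mul] at h
    have hlt {k : ℕ} (hk : k ∈ (Finset.range A.natDegree : Set ℕ)) : k * b.natDegree < n :=
      Nat.mul_lt_mul_of_pos_right (by simpa using hk) hm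
    exact Nat.eq_of_mul_eq_mul_right hm (hω.pow_inj (hlt hi) (hlt hj) h)
  set Z := (Finset.range A.natDegree).image fun j : ℕ => rotate (ω ^ j) (aeval x b) with hZ
  have hcard : Z.card = A.natDegree := by
    rw [hZ, Finset.card_image_of_injOn hinj, Finset.card_range]
  have hζn : ζ ^ n = 1 := by rw [hn, mul_comm, pow_mul, hζ, one_pow]
  have hmem : rotate ζ (aeval x b) ∈ Z := by
    by_contra hnot
    have hle := card_le_degree_of_subset_roots (p := p) (Z := insert (rotate ζ (aeval x b)) Z) (by
      intro z hz
      rw [Finset.mem_val, Finset.mem_insert, hZ, Finset.mem_image] at hz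
      obtain rfl | ⟨j, -, rfl⟩ := hz
      · exact hroot ζ hζn
      · exact hroot _ (hωpow j))
    rw [Finset.card_insert_of_notMem hnot, hcard, hdeg] at hle
    omega
  obtain ⟨j, hj, hjζ⟩ := Finset.mem_image.mp hmem
  have h := hx.pow_eq_of_rotate_eq hb hjζ
  rw [hζ, ← pow_mul, hω.pow_eq_one_iff_dvd, hn] at h
  have hj0 : j = 0 :=
    Nat.eq_zero_of_dvd_of_lt (Nat.dvd_of_mul_dvd_mul_right hm h) (Finset.mem_range.mp hj)
  rw [← hjζ, hj0, pow_zero]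
  ext i
  simp

theorem eq_prod_X_sub_C_of_injective {K ι : Type*} [Field K] [Fintype ι] {y : ι → K}
    (hy : Function.Injective y) {p : K[X]} (hp : p.Monic) (hdeg : p.natDegree = Fintype.card ι)
    (hroot : ∀ i, p.eval (y i) = 0) : p = ∏ i, (X - C (y i)) := by
  refine eq_of_monic_of_dvd_of_natDegree_le (monic_prod_X_sub_C y _) hp ?_ ?_
  · exact Finset.prod_dvd_of_coprime (fun i _ j _ hij => pairwise_coprime_X_sub_C hy hij)
      fun i _ => dvd_iff_isRoot.mpr (hroot i)
  · rw [natDegree_prod_of_monic _ _ fun i _ => monic_X_sub_C (y i)]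
    simp [hdeg]

/-- The monic polynomial whose roots are the conjugates of `x` under the rotations by `m`-th roots
of unity. -/
noncomputable def rotatePoly (m : ℕ) [NeZero m] (x : ℂ⸨X⸩) : (ℂ⸨X⸩)[X] :=
  ∏ ζ : rootsOfUnity m ℂ, (X - C (rotate ζ x))

/-- The coefficients of `rotatePoly m x` are polynomials in `x`. -/
def IsPolynomialOrbit (m : ℕ) [NeZero m] (x : ℂ⸨X⸩) : Prop :=
  ∃ M : ℂ[X][X], M.Monic ∧ M.map (aeval x : ℂ[X] →ₐ[ℂ] ℂ⸨X⸩).toRingHom = rotatePoly m x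

theorem IsExpansionAtInfinity.isPolynomialOrbit {x : ℂ⸨X⸩} (hx : IsExpansionAtInfinity x)
    {m : ℕ} [NeZero m] {b : ℂ[X]} (hb : b.natDegree = m) (hs : SupportedOn m (aeval x b)) :
    IsPolynomialOrbit m x := by
  have hm : m ≠ 0 := NeZero.ne m
  have hb0 : b.leadingCoeff ≠ 0 := by
    rw [leadingCoeff_ne_zero]
    rintro rfl
    simp [eq_comm, hm] at hb
  have hd : (b.map (C : ℂ →+* ℂ[X]) - C b).natDegree = m := by
    rw [natDegree_sub_C, natDegree_map_eq_of_injective C_injective, hb]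
  have hM : (C (C b.leadingCoeff⁻¹) * (b.map (C : ℂ →+* ℂ[X]) - C b)).Monic := by
    refine monic_C_mul_of_mul_leadingCoeff_eq_one ?_
    rw [leadingCoeff.eq_1 (_ - _), hd, coeff_sub, coeff_C_of_ne_zero hm, sub_zero, coeff_map, ← hb,
      coeff_natDegree, ← C_mul, inv_mul_cancel₀ hb0, C_1]
  refine ⟨_, hM, ?_⟩
  refine eq_prod_X_sub_C_of_injective (y := fun ζ : rootsOfUnity m ℂ => rotate ζ x)
    (hx.rotate_injective.comp Subtype.val_injective) (hM.map _) ?_ fun ζ => ?_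
  · rw [fintype_card_rootsOfUnity, hM.natDegree_map, natDegree_C_mul (by simpa using hb0), hd]
  · have h1 : (aeval x : ℂ[X] →ₐ[ℂ] ℂ⸨X⸩).toRingHom.comp C = algebraMap ℂ ℂ⸨X⸩ := by
      ext c : 1
      simp
    rw [Polynomial.map_mul, eval_mul, Polynomial.map_sub, Polynomial.map_map, h1, eval_sub,
      eval_map_algebraMap, aeval_algHom_apply, (supportedOn_iff_rotate hm _).mp hs ζ, map_C, eval_C]
    simp

theorem aeval_mem_of_isSymmetric {R A ι : Type*} [CommRing R] [CommRing A] [Algebra R A]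
    [Fintype ι] (S : Subalgebra R A) {y : ι → A}
    (hS : ∀ k, (∏ i, (X - C (y i))).coeff k ∈ S) {p : MvPolynomial ι R} (hp : p.IsSymmetric) :
    MvPolynomial.aeval y p ∈ S := by
  obtain ⟨q, hq⟩ := MvPolynomial.esymmAlgHom_surjective (σ := ι) (n := Fintype.card ι) R le_rfl
    ⟨p, hp⟩
  have hq' := MvPolynomial.esymmAlgHom_apply (σ := ι) q
  rw [hq] at hq'
  change p = _ at hq'
  rw [hq', ← AlgHom.comp_apply, MvPolynomial.comp_aeval]
  have hmem : ∀ i : Fin (Fintype.card ι),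
      MvPolynomial.aeval y (MvPolynomial.esymm ι R (i + 1)) ∈ S := by
    intro i
    have hc := Multiset.prod_X_sub_C_coeff (Finset.univ.val.map y)
      (k := Fintype.card ι - (i + 1)) (by simp)
    have hk := hS (Fintype.card ι - (i + 1))
    rw [Multiset.map_map] at hc
    change (∏ i, (X - C (y i))).coeff _ = _ at hc
    rw [hc, Multiset.card_map, Finset.card_val, Finset.card_univ,
      Nat.sub_sub_self i.2, ← MvPolynomial.aeval_esymm_eq_multiset_esymm ι R] at hk
    have := S.mul_mem (S.pow_mem (S.neg_mem S.one_mem) (i + 1)) hk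
    rwa [← mul_assoc, ← mul_pow, neg_one_mul, neg_neg, one_pow, one_mul] at this
  refine (?_ : (MvPolynomial.aeval _ : MvPolynomial (Fin (Fintype.card ι)) R →ₐ[R] A).range ≤ S)
    ⟨q, rfl⟩
  rw [MvPolynomial.aeval_range, Algebra.adjoin_le_iff]
  rintro _ ⟨i, rfl⟩
  exact hmem i

theorem IsPolynomialOrbit.exists_aeval_eq_rotateSum {m : ℕ} [NeZero m] {x : ℂ⸨X⸩}
    (h : IsPolynomialOrbit m x) (P : ℂ[X]) : ∃ w : ℂ[X], aeval x w = rotateSum m (aeval x P) := by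
  obtain ⟨M, -, hM⟩ := h
  have hp : (∑ ζ : rootsOfUnity m ℂ,
      aeval (MvPolynomial.X ζ : MvPolynomial (rootsOfUnity m ℂ) ℂ) P).IsSymmetric := by
    intro e
    simp only [map_sum, ← aeval_algHom_apply, MvPolynomial.rename_X]
    exact Equiv.sum_comp e fun ζ => aeval (MvPolynomial.X ζ) P
  have := aeval_mem_of_isSymmetric (aeval x : ℂ[X] →ₐ[ℂ] ℂ⸨X⸩).range
    (y := fun ζ : rootsOfUnity m ℂ => rotate ζ x) (by
      intro k
      have := congrArg (fun p => coeff p k) hM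
      rw [rotatePoly] at this
      rw [← this, coeff_map]
      exact ⟨_, rfl⟩) hp
  obtain ⟨w, hw⟩ := this
  refine ⟨w, ?_⟩
  have hw' : aeval x w = _ := hw
  rw [hw', map_sum, rotateSum]
  simp only [← aeval_algHom_apply, MvPolynomial.aeval_X]

theorem SupportedOn.sub {m : ℕ} {y z : ℂ⸨X⸩} (hy : SupportedOn m y) (hz : SupportedOn m z) :
    SupportedOn m (y - z) := by
  intro i hi
  by_contra h
  refine hi ?_
  rw [HahnSeries.coeff_sub, not_ne_iff.mp (mt (hy i) h), not_ne_iff.mp (mt (hz i) h), sub_zero]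

theorem SupportedOn.aeval {m : ℕ} (hm : m ≠ 0) {z : ℂ⸨X⸩} (hz : SupportedOn m z) (P : ℂ[X]) :
    SupportedOn m (aeval z P) := by
  rw [supportedOn_iff_rotate hm] at hz ⊢
  intro ζ
  rw [← aeval_algHom_apply, hz]

theorem IsExpansionAtInfinity.exists_eq_comp {x : ℂ⸨X⸩} (hx : IsExpansionAtInfinity x)
    {w : ℂ[X]} (hw0 : 0 < w.natDegree) (hw : SupportedOn w.natDegree (aeval x w)) (h : ℂ[X])
    (hh : SupportedOn w.natDegree (aeval x h)) : ∃ A : ℂ[X], h = A.comp w := by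
  induction hd : h.natDegree using Nat.strong_induction_on generalizing h with
  | _ d ih =>
    by_cases hd0 : d = 0
    · obtain ⟨c, rfl⟩ := natDegree_eq_zero.mp (hd.trans hd0)
      exact ⟨C c, by simp⟩
    have hlc : h.leadingCoeff ≠ 0 := by
      rw [leadingCoeff_ne_zero]
      rintro rfl
      exact hd0 (by simpa using hd.symm)
    have hdvd : w.natDegree ∣ h.natDegree := by
      have := hh (-(h.natDegree : ℤ)) (by rwa [(hx h).2])
      rwa [dvd_neg, Int.natCast_dvd_natCast] at this
    obtain ⟨j, hj⟩ := hdvd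
    have hwlc : w.leadingCoeff ≠ 0 := by
      rw [leadingCoeff_ne_zero]
      rintro rfl
      simp at hw0
    set B : ℂ[X] := C (h.leadingCoeff / w.leadingCoeff ^ j) * X ^ j with hB
    have hq0 : h.leadingCoeff / w.leadingCoeff ^ j ≠ 0 := div_ne_zero hlc (pow_ne_zero _ hwlc)
    have hBd : B.natDegree = j := natDegree_C_mul_X_pow _ _ hq0
    have hBw : (B.comp w).natDegree = h.natDegree := by rw [natDegree_comp, hBd, hj, mul_comm]
    have hBl : (B.comp w).leadingCoeff = h.leadingCoeff := by
      rw [leadingCoeff_comp hw0.ne', hBd, hB, leadingCoeff_C_mul_X_pow,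
        div_mul_cancel₀ _ (pow_ne_zero _ hwlc)]
    have hlt : (h - B.comp w).natDegree < d := by
      have hdeg : (h - B.comp w).degree < h.degree := by
        refine degree_sub_lt_left ?_ (leadingCoeff_ne_zero.mp hlc) hBl.symm
        rw [degree_eq_natDegree (leadingCoeff_ne_zero.mp hlc),
          degree_eq_natDegree (leadingCoeff_ne_zero.mp (hBl ▸ hlc)), hBw]
      by_cases hz : h - B.comp w = 0
      · rw [hz, natDegree_zero]
        omega
      · exact hd ▸ natDegree_lt_natDegree hz hdeg
    obtain ⟨A, hA⟩ := ih _ hlt (h - B.comp w) (by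
      rw [map_sub, aeval_comp]
      exact hh.sub (hw.aeval hw0.ne' B)) rfl
    exact ⟨A + B, by rw [add_comp, ← hA, sub_add_cancel]⟩

theorem coprime_prod_X_sub_C {K ι κ : Type*} [Field K] {s : Finset ι} {t : Finset κ} {y : ι → K}
    {z : κ → K} (h : ∀ i ∈ s, ∀ j ∈ t, y i ≠ z j) :
    IsCoprime (∏ i ∈ s, (X - C (y i))) (∏ j ∈ t, (X - C (z j))) :=
  IsCoprime.prod_left fun i hi => IsCoprime.prod_right fun j hj =>
    isCoprime_X_sub_C_of_isUnit_sub (sub_ne_zero.mpr (h i hi j hj)).isUnit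

theorem exists_rotatePoly_eq_mul {m k : ℕ} [NeZero m] [NeZero k] (h : k ∣ m) (x : ℂ⸨X⸩) :
    ∃ s : Finset (rootsOfUnity m ℂ), (∀ ζ, ζ ∈ s ↔ (ζ : ℂˣ) ^ k ≠ 1) ∧
      rotatePoly m x = rotatePoly k x * ∏ ζ ∈ s, (X - C (rotate ζ x)) := by
  classical
  refine ⟨Finset.univ.filter fun ζ => (ζ : ℂˣ) ^ k ≠ 1, by simp, ?_⟩
  rw [rotatePoly, ← Finset.prod_filter_mul_prod_filter_not Finset.univ
    (fun ζ : rootsOfUnity m ℂ => (ζ : ℂˣ) ^ k = 1)]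
  congr 1
  symm
  refine Finset.prod_bij (fun ζ _ => ⟨ζ, rootsOfUnity_le_of_dvd h ζ.2⟩) ?_ ?_ ?_ ?_
  · intro ζ _
    exact Finset.mem_filter.mpr ⟨Finset.mem_univ _, ζ.2⟩
  · intro ζ _ ξ _ hζξ
    exact Subtype.ext (congrArg (fun u : rootsOfUnity m ℂ => (u : ℂˣ)) hζξ)
  · intro ζ hζ
    exact ⟨⟨ζ, (Finset.mem_filter.mp hζ).2⟩, Finset.mem_univ _, rfl⟩
  · intro ζ _
    rfl

theorem exists_monic_map_associated_gcd {R K : Type*} [CommRing R] [IsDomain R]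
    [IsIntegrallyClosed R] [Field K] [DecidableEq K] {φ : R →+* K} (hφ : Function.Injective φ)
    {M N : R[X]} (hM : M.Monic) :
    ∃ E : R[X], E.Monic ∧ Associated (E.map φ) (EuclideanDomain.gcd (M.map φ) (N.map φ)) := by
  classical
  let ψ : FractionRing R →+* K := IsFractionRing.lift hφ
  have hψ : ψ.comp (algebraMap R (FractionRing R)) = φ :=
    RingHom.ext fun p => IsFractionRing.lift_algebraMap hφ p
  set ι := algebraMap R (FractionRing R)
  set D := EuclideanDomain.gcd (M.map ι) (N.map ι) with hD
  have hDM : D ∣ M.map ι := EuclideanDomain.gcd_dvd_left _ _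
  have hD0 : D ≠ 0 := fun h => (hM.map ι).ne_zero (zero_dvd_iff.mp (h ▸ hDM))
  obtain ⟨E, hE⟩ := IsIntegrallyClosed.eq_map_mul_C_of_dvd (FractionRing R) hM hDM
  have hlc : D.leadingCoeff ≠ 0 := leadingCoeff_ne_zero.mpr hD0
  refine ⟨E, ?_, ?_⟩
  · have h := congrArg leadingCoeff hE
    rw [leadingCoeff_mul, leadingCoeff_C, mul_eq_right₀ hlc] at h
    exact monic_of_injective (IsFractionRing.injective R _) h
  · have hDψ : D.map ψ = EuclideanDomain.gcd (M.map φ) (N.map φ) := by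
      rw [hD, ← Polynomial.gcd_map, Polynomial.map_map, Polynomial.map_map, hψ]
    rw [← hDψ, ← hE, Polynomial.map_mul, Polynomial.map_map, hψ, map_C]
    exact associated_mul_unit_right _ _ (isUnit_C.mpr ((map_ne_zero ψ).mpr hlc).isUnit)

theorem IsExpansionAtInfinity.gcd_rotatePoly_dvd {x : ℂ⸨X⸩} (hx : IsExpansionAtInfinity x)
    {m k : ℕ} [NeZero m] [NeZero k] [NeZero (m.gcd k)] {D : (ℂ⸨X⸩)[X]}
    (hm : D ∣ rotatePoly m x) (hk : D ∣ rotatePoly k x) : D ∣ rotatePoly (m.gcd k) x := by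
  obtain ⟨s, hs, hms⟩ := exists_rotatePoly_eq_mul (Nat.gcd_dvd_left m k) x
  have hcop : IsCoprime D (∏ ζ ∈ s, (X - C (rotate ζ x))) := by
    refine IsCoprime.of_isCoprime_of_dvd_left ?_ hk
    refine coprime_prod_X_sub_C fun ζ _ ξ hξ h => (hs ξ).mp hξ ?_
    have h' : (ζ : ℂˣ) = ξ := hx.rotate_injective h
    exact pow_gcd_eq_one.mpr ⟨ξ.2, h' ▸ ζ.2⟩
  exact hcop.dvd_of_dvd_mul_right (hms ▸ hm)

theorem IsExpansionAtInfinity.isPolynomialOrbit_gcd {x : ℂ⸨X⸩} (hx : IsExpansionAtInfinity x)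
    {m k : ℕ} [NeZero m] [NeZero k] [NeZero (m.gcd k)] (hm : IsPolynomialOrbit m x)
    (hk : IsPolynomialOrbit k x) : IsPolynomialOrbit (m.gcd k) x := by
  classical
  obtain ⟨M, hM, hMx⟩ := hm
  obtain ⟨N, -, hNx⟩ := hk
  obtain ⟨E, hE, hEx⟩ := exists_monic_map_associated_gcd (N := N)
    (φ := (aeval x : ℂ[X] →ₐ[ℂ] ℂ⸨X⸩).toRingHom) hx.aeval_injective hM
  rw [hMx, hNx] at hEx
  refine ⟨E, hE, eq_of_monic_of_associated (hE.map _) (monic_prod_X_sub_C _ _) (hEx.trans ?_)⟩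
  obtain ⟨_, -, hms⟩ := exists_rotatePoly_eq_mul (Nat.gcd_dvd_left m k) x
  obtain ⟨_, -, hkt⟩ := exists_rotatePoly_eq_mul (Nat.gcd_dvd_right m k) x
  exact associated_of_dvd_dvd
    (hx.gcd_rotatePoly_dvd (EuclideanDomain.gcd_dvd_left _ _) (EuclideanDomain.gcd_dvd_right _ _))
    (EuclideanDomain.dvd_gcd (Dvd.intro _ hms.symm) (Dvd.intro _ hkt.symm))

/-- `m` is the degree of a polynomial `b` such that `f = A ∘ b` for some `A`. -/
def IsRightFactorDegree (f : ℂ[X]) (m : ℕ) : Prop :=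
  ∃ A b : ℂ[X], f = A.comp b ∧ b.natDegree = m

theorem IsRightFactorDegree.dvd {f : ℂ[X]} {m : ℕ} (h : IsRightFactorDegree f m) :
    m ∣ f.natDegree := by
  obtain ⟨A, b, rfl, rfl⟩ := h
  rw [natDegree_comp]
  exact dvd_mul_left _ _

theorem IsRightFactorDegree.isPolynomialOrbit {f : ℂ[X]} (hf : 0 < f.natDegree) {m : ℕ} [NeZero m]
    (h : IsRightFactorDegree f m) {x : ℂ⸨X⸩} (hx : IsExpansionAtInfinity x)
    (hxf : SupportedOn f.natDegree (aeval x f)) : IsPolynomialOrbit m x := by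
  obtain ⟨A, b, rfl, rfl⟩ := h
  exact hx.isPolynomialOrbit rfl (hx.supportedOn_of_comp hf hxf)

theorem IsExpansionAtInfinity.isRightFactorDegree {f : ℂ[X]} {x : ℂ⸨X⸩}
    (hx : IsExpansionAtInfinity x) (hxf : SupportedOn f.natDegree (aeval x f)) {m : ℕ} (hm : m ≠ 0)
    (hmf : m ∣ f.natDegree) {w : ℂ[X]} {c : ℂ} (hc : c ≠ 0) (hw : HasLeadingTerm (aeval x w) m c)
    (hs : SupportedOn m (aeval x w)) : IsRightFactorDegree f m := by
  have hwd : w.natDegree = m := hx.natDegree_eq hw hc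
  subst hwd
  obtain ⟨A, hA⟩ := hx.exists_eq_comp (Nat.pos_of_ne_zero hm) hs f (hxf.mono hmf)
  exact ⟨A, w, hA, rfl⟩

theorem HasLeadingTerm.rotateSum {m d : ℕ} [NeZero m] (h : m ∣ d) {z : ℂ⸨X⸩} {c : ℂ}
    (hz : HasLeadingTerm z d c) : HasLeadingTerm (rotateSum m z) d (m * c) := by
  refine ⟨fun i hi => coeff_rotateSum_eq_zero m (hz.1 i hi), ?_⟩
  rw [coeff_rotateSum_of_dvd z (dvd_neg.mpr (Int.natCast_dvd_natCast.mpr h)), hz.2]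

theorem IsExpansionAtInfinity.hasLeadingTerm_pow {x : ℂ⸨X⸩} (hx : IsExpansionAtInfinity x)
    (d : ℕ) : HasLeadingTerm (aeval x (X ^ d : ℂ[X])) d 1 := by
  simpa using hx (X ^ d)

theorem IsRightFactorDegree.gcd {f : ℂ[X]} (hf : 0 < f.natDegree) {m k : ℕ}
    (hm : IsRightFactorDegree f m) (hk : IsRightFactorDegree f k) :
    IsRightFactorDegree f (m.gcd k) := by
  have : NeZero m := ⟨(Nat.pos_of_dvd_of_pos hm.dvd hf).ne'⟩
  have : NeZero k := ⟨(Nat.pos_of_dvd_of_pos hk.dvd hf).ne'⟩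
  have : NeZero (m.gcd k) := ⟨(Nat.gcd_pos_of_pos_left k (NeZero.pos m)).ne'⟩
  obtain ⟨x, hx, hxf⟩ := exists_isExpansionAtInfinity hf
  obtain ⟨w, hw⟩ := (hx.isPolynomialOrbit_gcd (hm.isPolynomialOrbit hf hx hxf)
    (hk.isPolynomialOrbit hf hx hxf)).exists_aeval_eq_rotateSum (X ^ m.gcd k)
  refine hx.isRightFactorDegree hxf (NeZero.ne _) ((Nat.gcd_dvd_left m k).trans hm.dvd)
    (mul_ne_zero (Nat.cast_ne_zero.mpr (NeZero.ne _)) one_ne_zero)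
    (hw ▸ (hx.hasLeadingTerm_pow _).rotateSum dvd_rfl) (hw ▸ supportedOn_rotateSum _ _)

theorem IsRightFactorDegree.lcm {f : ℂ[X]} (hf : 0 < f.natDegree) {m k : ℕ}
    (hm : IsRightFactorDegree f m) (hk : IsRightFactorDegree f k) :
    IsRightFactorDegree f (m.lcm k) := by
  have : NeZero m := ⟨(Nat.pos_of_dvd_of_pos hm.dvd hf).ne'⟩
  have : NeZero k := ⟨(Nat.pos_of_dvd_of_pos hk.dvd hf).ne'⟩
  obtain ⟨x, hx, hxf⟩ := exists_isExpansionAtInfinity hf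
  obtain ⟨v, hv⟩ := (hk.isPolynomialOrbit hf hx hxf).exists_aeval_eq_rotateSum (X ^ m.lcm k)
  obtain ⟨w, hw⟩ := (hm.isPolynomialOrbit hf hx hxf).exists_aeval_eq_rotateSum v
  rw [hv] at hw
  refine hx.isRightFactorDegree hxf (Nat.lcm_ne_zero (NeZero.ne m) (NeZero.ne k))
    (Nat.lcm_dvd hm.dvd hk.dvd) (c := m * (k * 1)) (by simp [NeZero.ne m, NeZero.ne k])
    (hw ▸ ((hx.hasLeadingTerm_pow _).rotateSum (Nat.dvd_lcm_right m k)).rotateSum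
      (Nat.dvd_lcm_left m k)) ?_
  rw [hw]
  exact (supportedOn_rotateSum m _).lcm (rotateSum_comm m k _ ▸ supportedOn_rotateSum k _)

theorem exists_eq_comp_of_natDegree_dvd {A B b d : ℂ[X]} (hf : 0 < (A.comp b).natDegree)
    (h : A.comp b = B.comp d) (hdvd : b.natDegree ∣ d.natDegree) : ∃ g : ℂ[X], d = g.comp b := by
  obtain ⟨x, hx, hxf⟩ := exists_isExpansionAtInfinity hf
  have hb := hx.supportedOn_of_comp hf hxf
  rw [h] at hf hxf
  refine hx.exists_eq_comp ?_ hb d ((hx.supportedOn_of_comp hf hxf).mono hdvd)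
  rw [← h, natDegree_comp] at hf
  exact Nat.pos_of_mul_pos_left hf

/-- In the divisibility order on `S`, the element `c` is a maximal proper divisor of `a`. -/
def IsMaxDivisor (S : Set ℕ) (c a : ℕ) : Prop :=
  c ∣ a ∧ c ≠ a ∧ ∀ s ∈ S, c ∣ s → s ∣ a → s = c ∨ s = a

/-- `MaxChain S a L` says that `L` is the list of successive quotients of a maximal chain of
divisors in `S` descending from `a` to `1`. -/
inductive MaxChain (S : Set ℕ) : ℕ → List ℕ → Prop
  | nil : MaxChain S 1 []
  | cons {c d : ℕ} {L : List ℕ} (hc : c ∈ S) (h : IsMaxDivisor S c (d * c)) (hL : MaxChain S c L) :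
      MaxChain S (d * c) (d :: L)

theorem exists_maxChain {S : Set ℕ} (h1 : 1 ∈ S) (a : ℕ) (ha0 : a ≠ 0) :
    ∃ L, MaxChain S a L := by
  induction a using Nat.strong_induction_on with
  | _ a ih =>
    by_cases ha1 : a = 1
    · exact ⟨[], ha1 ▸ .nil⟩
    classical
    let T := a.properDivisors.filter (· ∈ S)
    have hT : T.Nonempty := ⟨1, by simp [T, h1]; omega⟩
    obtain ⟨c, hcT, hmax⟩ := T.exists_max_image id hT
    simp only [T, Finset.mem_filter, Nat.mem_properDivisors] at hcT
    obtain ⟨⟨hca, hlt⟩, hcS⟩ := hcT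
    obtain ⟨L, hL⟩ := ih c hlt (ne_zero_of_dvd_ne_zero ha0 hca)
    obtain ⟨d, rfl⟩ := exists_eq_mul_left_of_dvd hca
    refine ⟨d :: L, .cons hcS ⟨hca, hlt.ne, fun s hs hcs hsa => ?_⟩ hL⟩
    by_contra! hne
    have hslt := lt_of_le_of_ne (Nat.le_of_dvd (Nat.pos_of_ne_zero ha0) hsa) hne.2
    have hle : s ≤ c := hmax s (by simp [T, hs, hsa, hslt])
    exact hne.1 (le_antisymm hle
      (Nat.le_of_dvd (Nat.pos_of_ne_zero (ne_zero_of_dvd_ne_zero ha0 hsa)) hcs))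

theorem IsMaxDivisor.lcm_eq {S : Set ℕ} (hlcm : ∀ m ∈ S, ∀ k ∈ S, m.lcm k ∈ S) {a c c' : ℕ}
    (hc : c ∈ S) (hc' : c' ∈ S) (h : IsMaxDivisor S c a) (h' : IsMaxDivisor S c' a)
    (hne : c ≠ c') : c.lcm c' = a := by
  refine (h.2.2 _ (hlcm _ hc _ hc') (Nat.dvd_lcm_left _ _)
    (Nat.lcm_dvd h.1 h'.1)).resolve_left fun he => ?_
  exact (h'.2.2 c hc (he ▸ Nat.dvd_lcm_right c c') h.1).elim hne h.2.1

theorem IsMaxDivisor.gcd {S : Set ℕ} (hlcm : ∀ m ∈ S, ∀ k ∈ S, m.lcm k ∈ S) {a c c' : ℕ}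
    (ha0 : a ≠ 0) (hc : c ∈ S) (hc' : c' ∈ S) (h : IsMaxDivisor S c a) (h' : IsMaxDivisor S c' a)
    (hne : c ≠ c') : IsMaxDivisor S (c.gcd c') c := by
  refine ⟨Nat.gcd_dvd_left _ _, fun he => ?_, fun s hs hgs hsc => ?_⟩
  · exact (h.2.2 c' hc' (he ▸ Nat.gcd_dvd_right c c') h'.1).elim hne.symm h'.2.1
  · have ht := h'.2.2 _ (hlcm s hs c' hc') (Nat.dvd_lcm_right _ _)
      (Nat.lcm_dvd (hsc.trans h.1) h'.1)
    obtain ht | ht := ht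
    · exact .inl (Nat.dvd_antisymm (Nat.dvd_gcd hsc (ht ▸ Nat.dvd_lcm_left s c')) hgs)
    · have hg : s.gcd c' = c.gcd c' := Nat.dvd_antisymm (Nat.gcd_dvd_gcd_of_dvd_left _ hsc)
        (Nat.dvd_gcd hgs (Nat.gcd_dvd_right _ _))
      have e1 := Nat.gcd_mul_lcm s c'
      have e2 := Nat.gcd_mul_lcm c c'
      rw [hg, ht] at e1
      rw [h.lcm_eq hlcm hc hc' h' hne] at e2
      exact .inr (Nat.eq_of_mul_eq_mul_right
        (Nat.pos_of_ne_zero (ne_zero_of_dvd_ne_zero ha0 h'.1)) (e1.symm.trans e2))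

theorem MaxChain.perm {S : Set ℕ} (h1 : 1 ∈ S) (hlcm : ∀ m ∈ S, ∀ k ∈ S, m.lcm k ∈ S)
    (hgcd : ∀ m ∈ S, ∀ k ∈ S, m.gcd k ∈ S) {a : ℕ} (ha0 : a ≠ 0)
    {L L' : List ℕ} (hL : MaxChain S a L) (hL' : MaxChain S a L') : L.Perm L' := by
  induction a using Nat.strong_induction_on generalizing L L' with
  | _ a ih =>
    have hone {c d : ℕ} (h : d * c = 1) : ¬ IsMaxDivisor S c (d * c) := fun hm =>
      hm.2.1 (by rw [h, Nat.eq_one_of_mul_eq_one_left h])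
    cases hL with
    | nil =>
      generalize ha : 1 = a at hL'
      cases hL' with
      | nil => exact .refl _
      | cons _ h _ => exact absurd h (hone ha.symm)
    | @cons c d L hc h hL =>
      generalize ha : d * c = a at *
      cases hL' with
      | nil => exact absurd (ha ▸ h) (hone ha)
      | @cons c' d' L' hc' h' hL' =>
        have hc0 : c ≠ 0 := ne_zero_of_dvd_ne_zero ha0 h.1
        have hc0' : c' ≠ 0 := ne_zero_of_dvd_ne_zero ha0 h'.1
        have hlt : c < d' * c' := lt_of_le_of_ne (Nat.le_of_dvd (by omega) h.1) h.2.1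
        have hlt' : c' < d' * c' := lt_of_le_of_ne (Nat.le_of_dvd (by omega) h'.1) h'.2.1
        by_cases hne : c = c'
        · subst hne
          rw [Nat.eq_of_mul_eq_mul_right (Nat.pos_of_ne_zero hc0) ha]
          exact (ih c hlt hc0 hL hL').cons d'
        have hg := h.gcd hlcm ha0 hc hc' h' hne
        have hg' := h'.gcd hlcm ha0 hc' hc h (Ne.symm hne)
        rw [Nat.gcd_comm] at hg'
        have hl := Nat.gcd_mul_lcm c c'
        rw [h.lcm_eq hlcm hc hc' h' hne] at hl
        have hgS := hgcd c hc c' hc'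
        generalize c.gcd c' = g at *
        have hg0 : g ≠ 0 := ne_zero_of_dvd_ne_zero hc0 hg.1
        obtain ⟨K, hK⟩ := exists_maxChain h1 g hg0
        obtain ⟨e, rfl⟩ := exists_eq_mul_left_of_dvd hg.1
        obtain ⟨e', rfl⟩ := exists_eq_mul_left_of_dvd hg'.1
        have hd' : d' = e := by
          have : d' * (g * (e' * g)) = e * (g * (e' * g)) := by linarith
          exact Nat.eq_of_mul_eq_mul_right (by positivity) this
        have hd : d = e' := by
          rw [← ha] at hl
          have : d * (g * (e * g)) = e' * (g * (e * g)) := by linarith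
          exact Nat.eq_of_mul_eq_mul_right (by positivity) this
        subst hd hd'
        calc (d :: L).Perm (d :: d' :: K) := (ih _ hlt hc0 hL (.cons hgS hg hK)).cons d
          _ |>.Perm (d' :: d :: K) := .swap _ _ _
          _ |>.Perm (d' :: L') := (ih _ hlt' hc0' (.cons hgS hg' hK) hL').cons d'

theorem Indecomposable.isMaxDivisor {f B u g : ℂ[X]} (hf : 0 < f.natDegree) (hu : Indecomposable u)
    (h : f = B.comp (u.comp g)) :
    IsMaxDivisor {m | IsRightFactorDegree f m} g.natDegree (u.natDegree * g.natDegree) := by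
  have hg : 0 < g.natDegree := by
    rw [h, natDegree_comp, natDegree_comp] at hf
    exact Nat.pos_of_mul_pos_left (Nat.pos_of_mul_pos_left hf)
  refine ⟨dvd_mul_left _ _, fun he => ?_, ?_⟩
  · have := hu.1
    nlinarith
  rintro s ⟨A, w, hw, rfl⟩ hgw hwu
  obtain ⟨β, rfl⟩ := exists_eq_comp_of_natDegree_dvd (A := B.comp u) (B := A)
    (by rwa [comp_assoc, ← h]) (by rw [comp_assoc, ← h, hw]) hgw
  obtain ⟨α, hα⟩ := exists_eq_comp_of_natDegree_dvd (A := A) (B := B) (d := u.comp g)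
    (by rwa [← hw]) (by rw [← h, hw]) (by rwa [natDegree_comp (p := u)])
  have huα : u = α.comp β := by
    rw [← comp_assoc, ← sub_eq_zero, ← sub_comp, comp_eq_zero_iff] at hα
    obtain hα | ⟨-, hα⟩ := hα
    · exact sub_eq_zero.mp hα
    · rw [hα, natDegree_C] at hg
      omega
  have hdeg : u.natDegree = α.natDegree * β.natDegree := by rw [huα, natDegree_comp]
  have hu1 := hu.1
  have hαβ : u.natDegree ≤ α.natDegree ∨ u.natDegree ≤ β.natDegree := by
    by_contra! hlt
    exact hu.2 ⟨α, β, hlt.1, hlt.2, huα⟩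
  rw [natDegree_comp]
  obtain hle | hle := hαβ
  · left
    have : β.natDegree = 1 := by
      have : β.natDegree ≠ 0 := by rintro h0; rw [h0] at hdeg; omega
      have : β.natDegree ≤ 1 := by by_contra! h2; nlinarith
      omega
    rw [this, one_mul]
  · right
    have : α.natDegree = 1 := by
      have : α.natDegree ≠ 0 := by rintro h0; rw [h0] at hdeg; omega
      have : α.natDegree ≤ 1 := by by_contra! h2; nlinarith
      omega
    rw [hdeg, this, one_mul]

theorem maxChain_of_indecomposable {f : ℂ[X]} (hf : 0 < f.natDegree) (U : List ℂ[X])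
    (hU : ∀ u ∈ U, Indecomposable u) (B : ℂ[X]) (h : f = B.comp (compList U)) :
    MaxChain {m | IsRightFactorDegree f m} (compList U).natDegree (U.map natDegree) := by
  induction U generalizing B with
  | nil => simpa [compList] using MaxChain.nil
  | cons u U ih =>
    have hcomp : compList (u :: U) = u.comp (compList U) := rfl
    rw [hcomp] at h ⊢
    have h' : f = (B.comp u).comp (compList U) := by rw [comp_assoc, ← h]
    rw [natDegree_comp, List.map_cons]
    exact .cons ⟨_, _, h', rfl⟩ ((hU u List.mem_cons_self).isMaxDivisor hf h)
      (ih (fun v hv => hU v (List.mem_cons_of_mem _ hv)) _ h')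

theorem exists_equiv_of_map_perm {α β γ : Type*} {f : α → γ} {g : β → γ} {U : List α} {V : List β}
    (h : (U.map f).Perm (V.map g)) :
    ∃ χ : Fin U.length ≃ Fin V.length, ∀ i, f (U.get i) = g (V.get (χ i)) := by
  classical
  let χ : Fin (U.map f).length ≃ Fin (V.map g).length :=
    ⟨h.idxBij, h.symm.idxBij, h.idxBij_symm_leftInverse_idxBij, h.idxBij_symm_rightInverse_idxBij⟩
  refine ⟨(finCongr (List.length_map f).symm).trans (χ.trans (finCongr (List.length_map g))),
    fun i => ?_⟩
  have hi := h.getElem_idxBij_eq_getElem (finCongr (List.length_map f).symm i)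
  rw [List.getElem_map, List.getElem_map] at hi
  exact hi.symm

theorem degrees_invariant
    (f : ℂ[X]) (hf : 1 < f.natDegree)
    (U V : List ℂ[X]) (hU : CompleteDecomp f U) (hV : CompleteDecomp f V) :
    U.length = V.length ∧
      ∃ χ : Fin U.length ≃ Fin V.length,
        ∀ i : Fin U.length, (U.get i).natDegree = (V.get (χ i)).natDegree := by
  have hf0 : 0 < f.natDegree := by omega
  have hchain {W : List ℂ[X]} (hW : CompleteDecomp f W) :
      MaxChain {m | IsRightFactorDegree f m} f.natDegree (W.map natDegree) := by
    have := maxChain_of_indecomposable hf0 W hW.1 X (by rw [X_comp, ← hW.2])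
    rwa [← hW.2] at this
  have hperm : (U.map natDegree).Perm (V.map natDegree) :=
    MaxChain.perm (S := {m | IsRightFactorDegree f m}) ⟨f, X, by simp, natDegree_X⟩
      (fun _ hm _ hk => hm.lcm hf0 hk)
      (fun _ hm _ hk => hm.gcd hf0 hk) hf0.ne' (hchain hU) (hchain hV)
  exact ⟨by simpa using hperm.length_eq, exists_equiv_of_map_perm hperm⟩
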